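/- arXiv:1802.08661 — 2 statements merged into one kernel-verified Lean document; each statement's English description precedes it below -/
import Mathlib

section
/- The third Cauchy beta-integral: for real (or complex) parameters x, y with Re(x+y) > 1, ∫_{-∞}^{∞} dt / ((1+it)^x (1-it)^y) = π · 2^{2-x-y} · Γ(x+y-1) / (Γ(x)·Γ(y)). -/
open Complex

open Set Filter Topology MeasureTheory FourierTransform in
lemma laplace_integrable {x r : ℂ} (hx : 0 < x.re) (hr : 0 < r.re) :
    IntegrableOn (fun s : ℝ => (s : ℂ) ^ (x - 1) * cexp (-(r * s))) (Ioi 0) := by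
  have h := integrableOn_rpow_mul_exp_neg_mul_rpow (p := 1) (s := x.re - 1) (b := r.re)
    (by linarith) one_pos hr
  refine Integrable.mono' h ?_ ?_
  · refine ContinuousOn.aestronglyMeasurable ?_ measurableSet_Ioi
    refine ContinuousOn.mul ?_ (by fun_prop)
    intro s hs
    exact ((continuousAt_cpow_const (ofReal_mem_slitPlane.2 hs)).comp
      continuous_ofReal.continuousAt).continuousWithinAt
  · refine (ae_restrict_iff' measurableSet_Ioi).mpr (Eventually.of_forall fun s hs => ?_)
    rw [norm_mul, norm_cpow_eq_rpow_re_of_pos hs, norm_exp]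
    simp

open Set Filter Topology MeasureTheory FourierTransform in
lemma laplace_diff {x : ℂ} (hx : 0 < x.re) {r : ℂ} (hr : 0 < r.re) :
    DifferentiableAt ℂ (fun r : ℂ => ∫ s in Ioi (0:ℝ), (s : ℂ) ^ (x - 1) * cexp (-(r * s))) r := by
  have hb := integrableOn_rpow_mul_exp_neg_mul_rpow (p := 1) (s := x.re) (b := r.re / 2)
    (by linarith) one_pos (by linarith)
  have hU : {z : ℂ | r.re / 2 < z.re} ∈ 𝓝 r :=
    (isOpen_lt continuous_const continuous_re).mem_nhds (by simp; linarith)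
  refine (hasDerivAt_integral_of_dominated_loc_of_deriv_le (μ := volume.restrict (Ioi 0))
    (F := fun (r : ℂ) (s : ℝ) => (s : ℂ) ^ (x - 1) * cexp (-(r * s)))
    (F' := fun r s => (s : ℂ) ^ (x - 1) * (cexp (-(r * s)) * (-(1 * s)))) hU ?_
    (laplace_integrable hx hr) ?_ ?_ hb ?_).2.differentiableAt
  · filter_upwards [hU] with z hz
    exact (laplace_integrable hx (by have hz' : r.re / 2 < z.re := hz; linarith)).aestronglyMeasurable
  · refine AEStronglyMeasurable.congr
      (((laplace_integrable hx hr).aestronglyMeasurable).mul (g := fun s : ℝ => (-(1 * (s:ℂ)))) 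
        (by fun_prop : Continuous (fun s : ℝ => (-(1 * (s:ℂ))))).aestronglyMeasurable) ?_
    exact Eventually.of_forall fun s => by simp [mul_assoc]
  · refine (ae_restrict_iff' measurableSet_Ioi).mpr (Eventually.of_forall fun s hs z hz => ?_)
    have hs' : (0:ℝ) < s := hs
    replace hz : r.re / 2 < z.re := hz
    rw [norm_mul, norm_mul, norm_cpow_eq_rpow_re_of_pos hs, norm_exp]
    have : s ^ x.re = s ^ (x - 1).re * s := by
      rw [← Real.rpow_add_one hs'.ne']; simp
    rw [this]
    simp only [norm_neg, one_mul, norm_real, Real.norm_eq_abs, abs_of_pos hs', Real.rpow_one]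
    rw [mul_assoc, mul_comm s]
    gcongr
    simp
    gcongr
  · refine (Eventually.of_forall fun s z hz => ?_)
    have : HasDerivAt (fun z : ℂ => -(z * (s:ℂ))) (-(1 * s)) z := ((hasDerivAt_id z).mul_const _).neg
    exact this.cexp.const_mul _

open Set Filter Topology MeasureTheory FourierTransform in
lemma laplace_eq {x r : ℂ} (hx : 0 < x.re) (hr : 0 < r.re) :
    ∫ s in Ioi (0:ℝ), (s : ℂ) ^ (x - 1) * cexp (-(r * s)) = r ^ (-x) * Gamma x := by
  have hUo : IsOpen {z : ℂ | 0 < z.re} := isOpen_lt continuous_const continuous_re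
  have key := AnalyticOnNhd.eqOn_of_preconnected_of_frequently_eq (U := {z : ℂ | 0 < z.re})
    (f := fun r : ℂ => ∫ s in Ioi (0:ℝ), (s : ℂ) ^ (x - 1) * cexp (-(r * s)))
    (g := fun r => r ^ (-x) * Gamma x) (z₀ := 1)
    (DifferentiableOn.analyticOnNhd (fun z hz => (laplace_diff hx hz).differentiableWithinAt) hUo)
    (DifferentiableOn.analyticOnNhd (fun z hz => by
      have : z ∈ slitPlane := Or.inl hz
      exact (((hasDerivAt_id z).cpow_const this).differentiableAt.mul_const _).differentiableWithinAt) hUo)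
    (convex_halfSpace_re_gt 0).isPreconnected (by simp) ?_
  · exact key hr
  · have ht : Tendsto (fun t : ℝ => (t : ℂ)) (𝓝[>] 1) (𝓝[≠] 1) := by
      refine tendsto_nhdsWithin_iff.2 ⟨?_, ?_⟩
      · exact (continuous_ofReal.tendsto' 1 1 (by simp)).mono_left nhdsWithin_le_nhds
      · filter_upwards [self_mem_nhdsWithin] with t ht
        simp only [mem_compl_iff, mem_singleton_iff]
        exact_mod_cast (ne_of_gt ht)
    refine ht.frequently (Eventually.frequently ?_)
    filter_upwards [self_mem_nhdsWithin] with t ht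
    have ht0 : 0 < t := lt_trans one_pos ht
    rw [integral_cpow_mul_exp_neg_mul_Ioi hx ht0]
    congr 1
    rw [one_div, inv_cpow _ _ (by rw [arg_ofReal_of_nonneg ht0.le]; exact Real.pi_pos.ne), cpow_neg]

lemma lin_ne (t : ℝ) : (1 + I * t : ℂ) ≠ 0 := fun h => by simpa using congrArg re h
lemma lin_ne' (t : ℝ) : (1 - I * t : ℂ) ≠ 0 := fun h => by simpa using congrArg re h
lemma lin_mem (t : ℝ) : (1 + I * t : ℂ) ∈ slitPlane := Or.inl (by simp)
lemma lin_mem' (t : ℝ) : (1 - I * t : ℂ) ∈ slitPlane := Or.inl (by simp)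

noncomputable def cphi (x y : ℂ) (t : ℝ) : ℂ := (1 + I * t) ^ (-x) * (1 - I * t) ^ (-y)

lemma cphi_deriv (x y : ℂ) (t : ℝ) :
    HasDerivAt (cphi x y) (-(I * x) * cphi (x + 1) y t + I * y * cphi x (y + 1) t) t := by
  have h1 : HasDerivAt (fun t : ℂ => 1 + I * t) I (t:ℂ) := by
    simpa using ((hasDerivAt_id (t:ℂ)).const_mul I).const_add 1
  have h2 : HasDerivAt (fun t : ℂ => 1 - I * t) (-I) (t:ℂ) := by
    simpa using ((hasDerivAt_id (t:ℂ)).const_mul I).const_sub 1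
  have := ((h1.cpow_const (c := -x) (lin_mem t)).mul
    (h2.cpow_const (c := -y) (lin_mem' t))).comp_ofReal
  convert! this using 1
  unfold cphi
  rw [neg_add', neg_add']
  ring

lemma cphi_cont (x y : ℂ) : Continuous (cphi x y) :=
  continuous_iff_continuousAt.2 fun t => (cphi_deriv x y t).continuousAt

lemma cphi_bound (x y : ℂ) (t : ℝ) :
    ‖cphi x y t‖ ≤ Real.exp (Real.pi * (|x.im| + |y.im|)) *
      (1 + ‖t‖ ^ 2) ^ (-(x + y).re / 2) := by
  have hn (z : ℂ) (hz : ‖z‖ ^ 2 = 1 + ‖t‖ ^ 2) (a : ℂ) : ‖z ^ (-a)‖ ≤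
      Real.exp (Real.pi * |a.im|) * (1 + ‖t‖ ^ 2) ^ (-a.re / 2) := by
    have hz0 : z ≠ 0 := by
      rintro rfl
      have : 0 < 1 + ‖t‖ ^ 2 := by positivity
      simp at hz; simp at this; linarith
    rw [norm_cpow_of_ne_zero hz0, div_eq_mul_inv, ← Real.exp_neg, mul_comm, ← hz,
      ← Real.rpow_natCast, ← Real.rpow_mul (norm_nonneg _)]
    have e : ((2:ℕ):ℝ) * (-a.re / 2) = (-a).re := by simp; ring
    rw [e]
    gcongr
    have : |z.arg * a.im| ≤ Real.pi * |a.im| := by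
      rw [abs_mul]; gcongr; exact abs_arg_le_pi z
    simpa using (le_abs_self _).trans this
  have e1 : ‖(1 + I * t : ℂ)‖ ^ 2 = 1 + ‖t‖ ^ 2 := by
    rw [← normSq_eq_norm_sq, normSq_apply]; simp; ring
  have e2 : ‖(1 - I * t : ℂ)‖ ^ 2 = 1 + ‖t‖ ^ 2 := by
    rw [← normSq_eq_norm_sq, normSq_apply]; simp; ring
  have hpos : 0 < 1 + ‖t‖ ^ 2 := by positivity
  calc ‖cphi x y t‖ = ‖(1 + I * t : ℂ) ^ (-x)‖ * ‖(1 - I * t : ℂ) ^ (-y)‖ := norm_mul _ _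
    _ ≤ _ := mul_le_mul (hn _ e1 x) (hn _ e2 y) (norm_nonneg _) (by positivity)
    _ = _ := by
      rw [mul_add, Real.exp_add, add_re, neg_add, add_div, Real.rpow_add hpos]; ring

open MeasureTheory in
lemma cphi_int {x y : ℂ} (h : 1 < (x + y).re) : Integrable (cphi x y) := by
  refine Integrable.mono' ((integrable_rpow_neg_one_add_norm_sq (E := ℝ) (μ := volume)
    (r := (x+y).re) (by simpa using h)).const_mul
    (Real.exp (Real.pi * (|x.im| + |y.im|)))) (cphi_cont x y).aestronglyMeasurable ?_
  exact Filter.Eventually.of_forall (cphi_bound x y)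

open Filter Topology in
lemma cphi_tendsto {x y : ℂ} (h : 0 < (x + y).re) : Tendsto (cphi x y) (cocompact ℝ) (𝓝 0) := by
  refine squeeze_zero_norm (cphi_bound x y) ?_
  rw [← mul_zero (Real.exp (Real.pi * (|x.im| + |y.im|)))]
  refine Tendsto.const_mul _ ?_
  have : Tendsto (fun t : ℝ => 1 + ‖t‖ ^ 2) (cocompact ℝ) atTop :=
    tendsto_atTop_add_const_left _ _
      ((tendsto_pow_atTop two_ne_zero).comp (tendsto_norm_cocompact_atTop (E := ℝ)))
  simpa only [neg_div] using! (tendsto_rpow_neg_atTop (half_pos h)).comp this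

noncomputable def cF (x y : ℂ) : ℂ := ∫ t, cphi x y t

lemma cF_ibp {x y : ℂ} (h : 0 < (x + y).re) : x * cF (x + 1) y = y * cF x (y + 1) := by
  have i1 : MeasureTheory.Integrable (cphi (x+1) y) := cphi_int (by simp at h ⊢; linarith)
  have i2 : MeasureTheory.Integrable (cphi x (y+1)) := cphi_int (by simp at h ⊢; linarith)
  have := MeasureTheory.integral_of_hasDerivAt_of_tendsto (cphi_deriv x y)
    ((i1.const_mul _).add (i2.const_mul _))
    ((cphi_tendsto h).mono_left atBot_le_cocompact) ((cphi_tendsto h).mono_left atTop_le_cocompact)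
  rw [MeasureTheory.integral_add (i1.const_mul _) (i2.const_mul _),
    MeasureTheory.integral_const_mul, MeasureTheory.integral_const_mul] at this
  change -(I * x) * cF (x+1) y + I * y * cF x (y+1) = 0 - 0 at this
  linear_combination I * this + (x * cF (x+1) y - y * cF x (y+1)) * I_sq

lemma cF_sum {x y : ℂ} (h : 0 < (x + y).re) : cF x (y + 1) + cF (x + 1) y = 2 * cF (x+1) (y + 1) := by
  have i1 : MeasureTheory.Integrable (cphi (x+1) y) := cphi_int (by simp at h ⊢; linarith)
  have i2 : MeasureTheory.Integrable (cphi x (y+1)) := cphi_int (by simp at h ⊢; linarith)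
  unfold cF
  rw [← MeasureTheory.integral_add i2 i1, ← MeasureTheory.integral_const_mul]
  congr 1
  ext t
  unfold cphi
  have e1 : -x = -(x+1) + 1 := by ring
  have e2 : -y = -(y+1) + 1 := by ring
  rw [e1, e2, cpow_add _ _ (lin_ne t), cpow_add _ _ (lin_ne' t), cpow_one, cpow_one]
  ring

noncomputable def gfun (x : ℂ) : ℝ → ℂ :=
  Set.indicator (Set.Ioi 0) (fun s : ℝ => (s : ℂ) ^ (x - 1) * cexp (-(1 * s)))

section
open Set Filter Topology MeasureTheory FourierTransform

lemma gfun_int {x : ℂ} (hx : 0 < x.re) : Integrable (gfun x) :=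
  (integrable_indicator_iff measurableSet_Ioi).2 (laplace_integrable hx (by simp))

lemma gfun_fourier {x : ℂ} (hx : 0 < x.re) (w : ℝ) :
    𝓕 (gfun x) w = (1 + I * (2 * Real.pi * w : ℝ)) ^ (-x) * Gamma x := by
  rw [Real.fourier_real_eq_integral_exp_smul, ← laplace_eq hx (by simp),
    ← integral_indicator measurableSet_Ioi]
  congr 1
  ext s
  by_cases hs : s ∈ Ioi (0:ℝ)
  · simp only [gfun, indicator_of_mem hs, smul_eq_mul]
    rw [mul_left_comm, ← Complex.exp_add]
    congr 2
    push_cast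
    ring
  · simp [gfun, indicator_of_notMem hs]

lemma gfun_contAt {x : ℂ} {s : ℝ} (hs : s ≠ 0) : ContinuousAt (gfun x) s := by
  rcases hs.lt_or_gt with h | h
  · refine continuousAt_const (y := (0:ℂ)) |>.congr ?_
    filter_upwards [Iio_mem_nhds h] with u hu
    have : u ∉ Ioi (0:ℝ) := by
      rw [mem_Ioi, not_lt]; exact le_of_lt hu
    simp [gfun, indicator_of_notMem this]
  · have : ContinuousAt (fun s : ℝ => (s : ℂ) ^ (x - 1) * cexp (-(1 * s))) s := by
      refine ContinuousAt.mul ?_ (by fun_prop)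
      exact (continuousAt_cpow_const (ofReal_mem_slitPlane.2 h)).comp
        continuous_ofReal.continuousAt
    refine this.congr ?_
    filter_upwards [Ioi_mem_nhds h] with u hu
    simp only [gfun, indicator_of_mem hu]

lemma cF_base {x y : ℂ} (hx : 1 < x.re) (hy : 1 < y.re) :
    cF x y * (Gamma x * Gamma y) =
      (Real.pi : ℂ) * (2 : ℂ) ^ (2 - x - y) * Gamma (x + y - 1) := by
  have hx0 : 0 < x.re := by linarith
  have hy0 : 0 < y.re := by linarith
  have hpi : (Real.pi : ℂ) ≠ 0 := by exact_mod_cast Real.pi_ne_zero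
  have hF : Integrable (𝓕 (gfun y)) := by
    have := ((cphi_int (x := y) (y := 0) (by simpa using hy)).comp_mul_left'
      (mul_ne_zero two_ne_zero Real.pi_ne_zero)).mul_const (Gamma y)
    refine this.congr (Eventually.of_forall fun w => ?_)
    simp only [gfun_fourier hy0]
    simp [cphi]
  have hFn : Integrable (fun w => 𝓕 (gfun y) (-w)) := hF.comp_neg
  have key : ∫ w, 𝓕 (gfun x) w • 𝓕 (gfun y) (-w) = ∫ v, gfun x v • 𝓕 (fun w => 𝓕 (gfun y) (-w)) v := by
    have := VectorFourier.integral_fourierIntegral_smul_eq_flip (L := innerₗ ℝ)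
      Real.continuous_fourierChar continuous_inner (gfun_int hx0) hFn
    rw [flip_innerₗ] at this
    exact this
  rw [← Real.fourierInv_eq_fourier_comp_neg] at key
  have e1 : ∫ w, 𝓕 (gfun x) w • 𝓕 (gfun y) (-w) = (2 * (Real.pi : ℂ))⁻¹ * (cF x y * (Gamma x * Gamma y)) := by
    have : ∀ w : ℝ, 𝓕 (gfun x) w • 𝓕 (gfun y) (-w) =
        cphi x y (2 * Real.pi * w) * (Gamma x * Gamma y) := by
      intro w
      rw [gfun_fourier hx0, gfun_fourier hy0, cphi, smul_eq_mul]
      have : (1 + I * (2 * Real.pi * -w : ℝ) : ℂ) = 1 - I * (2 * Real.pi * w : ℝ) := by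
        push_cast; ring
      rw [this]; ring
    simp_rw [this]
    rw [integral_mul_const, Measure.integral_comp_mul_left (cphi x y),
      abs_of_pos (by positivity), ← mul_assoc, real_smul]
    simp [cF, mul_assoc]
  have e2 : ∫ v, gfun x v • 𝓕⁻ (𝓕 (gfun y)) v = (2:ℂ) ^ (-(x + y - 1)) * Gamma (x + y - 1) := by
    rw [← laplace_eq (by simp; linarith) (by simp), ← integral_indicator measurableSet_Ioi]
    refine integral_congr_ae ?_
    have : ∀ᵐ v : ℝ, v ≠ 0 := by simp [ae_iff]
    filter_upwards [this] with v hv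
    rw [(gfun_int hy0).fourierInv_fourier_eq hF (gfun_contAt hv)]
    by_cases hs : v ∈ Ioi (0:ℝ)
    · simp only [gfun, indicator_of_mem hs, smul_eq_mul]
      have hv' : (v:ℂ) ≠ 0 := by exact_mod_cast hv
      have e : x + y - 1 - 1 = (x - 1) + (y - 1) := by ring
      have e' : -(2 * (v:ℂ)) = -(1 * v) + -(1 * v) := by ring
      rw [e, e', cpow_add _ _ hv', Complex.exp_add]
      ring
    · simp [gfun, indicator_of_notMem hs]
  rw [e1, e2] at key
  have e3 : (2:ℂ) ^ (2 - x - y) = 2 * (2:ℂ) ^ (-(x + y - 1)) := by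
    have : 2 - x - y = -(x + y - 1) + 1 := by ring
    rw [this, cpow_add _ _ two_ne_zero, cpow_one, mul_comm]
  rw [e3]
  field_simp at key
  linear_combination key

lemma cF_step_right {x y : ℂ} (h : 1 < (x + y).re) :
    (x + y - 1) * cF x y = 2 * y * cF x (y + 1) := by
  have h' : 0 < (x - 1 + y).re := by simp at h ⊢; linarith
  have a := cF_ibp h'
  have b := cF_sum h'
  rw [sub_add_cancel] at a b
  linear_combination a + y * b

lemma cF_step_left {x y : ℂ} (h : 1 < (x + y).re) :
    (x + y - 1) * cF x y = 2 * x * cF (x + 1) y := by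
  have h' : 0 < (x + (y - 1)).re := by simp at h ⊢; linarith
  have a := cF_ibp h'
  have b := cF_sum h'
  rw [sub_add_cancel] at a b
  linear_combination - a + x * b

/-- The claimed value of the integral. -/
noncomputable def cG (x y : ℂ) : ℂ :=
  (Real.pi : ℂ) * (2 : ℂ) ^ (2 - x - y) * Gamma (x + y - 1) * ((Gamma x)⁻¹ * (Gamma y)⁻¹)

lemma cG_symm (x y : ℂ) : cG x y = cG y x := by
  unfold cG
  rw [sub_right_comm, add_comm x y]; ring

lemma cG_step_right {x y : ℂ} (h : 1 < (x + y).re) :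
    (x + y - 1) * cG x y = 2 * y * cG x (y + 1) := by
  have h0 : x + y - 1 ≠ 0 := fun h0 => by
    have := congrArg re h0
    simp at this h; linarith
  unfold cG
  have e : x + (y + 1) - 1 = (x + y - 1) + 1 := by ring
  have e2 : 2 - x - y = (2 - x - (y + 1)) + 1 := by ring
  rw [e, Gamma_add_one _ h0, e2, cpow_add _ _ two_ne_zero, cpow_one,
    one_div_Gamma_eq_self_mul_one_div_Gamma_add_one y]
  ring

lemma cF_eq_cG (x y : ℂ) (h : 1 < (x + y).re) : cF x y = cG x y := by
  have ne {x y : ℂ} (h : 1 < (x + y).re) : x + y - 1 ≠ 0 := fun h0 => by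
    have := congrArg re h0
    simp at this h; linarith
  have hr (x : ℂ) (hx : 1 < x.re) (n : ℕ) : ∀ y : ℂ, 1 < (x + y).re → 1 < y.re + n →
      cF x y = cG x y := by
    induction n with
    | zero =>
      intro y h hy
      have hy' : 1 < y.re := by simpa using hy
      have := cF_base hx hy'
      have gx : Gamma x ≠ 0 := Gamma_ne_zero_of_re_pos (by linarith)
      have gy : Gamma y ≠ 0 := Gamma_ne_zero_of_re_pos (by linarith)
      unfold cG
      rw [← this]
      field_simp
    | succ n ih =>
      intro y h hy
      refine mul_left_cancel₀ (ne h) ?_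
      rw [cF_step_right h, cG_step_right h, ih (y + 1) (by simp at h ⊢; linarith)
        (by push_cast at hy; simp; linarith)]
  have hl (n : ℕ) : ∀ x : ℂ, 1 < (x + y).re → 1 < x.re + n → cF x y = cG x y := by
    induction n with
    | zero =>
      intro x h hx
      obtain ⟨n, hn⟩ := exists_nat_gt (1 - y.re)
      exact hr x (by simpa using hx) n y h (by linarith)
    | succ n ih =>
      intro x h hx
      refine mul_left_cancel₀ (ne h) ?_
      rw [cF_step_left h, cG_symm, add_comm x y, cG_step_right (by rwa [add_comm]), cG_symm y,
        ih (x + 1) (by simp at h ⊢; linarith) (by push_cast at hx; simp; linarith)]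
  obtain ⟨n, hn⟩ := exists_nat_gt (1 - x.re)
  exact hl n x h (by linarith)

end

/-- The third Cauchy beta-integral:
`∫ t, (1+it)^(-x) (1-it)^(-y) dt = π 2^(2-x-y) Γ(x+y-1)/(Γ(x)Γ(y))` for `Re(x+y) > 1`. -/
theorem cauchy_beta_integral (x y : ℂ) (h : 1 < (x + y).re) :
    ∫ t : ℝ, 1 / ((1 + I * t) ^ x * (1 - I * t) ^ y) =
      (Real.pi : ℂ) * (2 : ℂ) ^ (2 - x - y) * Complex.Gamma (x + y - 1) /
        (Complex.Gamma x * Complex.Gamma y) := by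
  have := cF_eq_cG x y h
  unfold cF cG cphi at this
  rw [div_eq_mul_inv, mul_inv, ← this]
  congr 1
  ext t
  rw [cpow_neg, cpow_neg, one_div, mul_inv]
end

section
/- For Re(s) > 1 the integral ∫_{-∞}^{∞} e^{-2πiνyu}(u - i)/(u² + 1)^s du converges absolutely, is holomorphic in s on Re(s) > 1/2 + ε for any ε making convergence hold (indeed for Re(s) ≥ 1 when ν ≠ 0 due to oscillation), and is uniformly bounded for Re(s) ≥ 1 independently of s. -/
open Complex MeasureTheory

noncomputable def osc (c u : ℝ) : ℂ := Complex.exp (((c * u : ℝ) : ℂ) * I)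

noncomputable def pw (r : ℂ) (u : ℝ) : ℂ := ((u : ℂ) ^ 2 + 1) ^ r

lemma base_cast (u : ℝ) : ((u : ℂ) ^ 2 + 1) = ((u ^ 2 + 1 : ℝ) : ℂ) := by push_cast; rfl

lemma base_ne (u : ℝ) : ((u : ℂ) ^ 2 + 1) ≠ 0 := by
  rw [base_cast]
  exact_mod_cast (by positivity : (u ^ 2 + 1 : ℝ) ≠ 0)

lemma base_slit (u : ℝ) : ((u : ℂ) ^ 2 + 1) ∈ slitPlane := by
  rw [base_cast]
  exact Complex.ofReal_mem_slitPlane.2 (by positivity)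

lemma norm_osc (c u : ℝ) : ‖osc c u‖ = 1 := Complex.norm_exp_ofReal_mul_I _

lemma norm_pw (r : ℂ) (u : ℝ) : ‖pw r u‖ = (u ^ 2 + 1) ^ r.re := by
  unfold pw
  rw [base_cast, Complex.norm_cpow_eq_rpow_re_of_pos (by positivity)]

lemma norm_pw_le (r : ℂ) (u a : ℝ) (h : r.re ≤ a) : ‖pw r u‖ ≤ (u ^ 2 + 1) ^ a := by
  rw [norm_pw]
  exact Real.rpow_le_rpow_of_exponent_le (by nlinarith [sq_nonneg u]) h

lemma norm_pw_le_inv (r : ℂ) (u : ℝ) (h : r.re ≤ -1) : ‖pw r u‖ ≤ (u ^ 2 + 1)⁻¹ := by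
  have := norm_pw_le r u (-1) h
  rwa [Real.rpow_neg_one] at this

lemma norm_sub_I (u : ℝ) : ‖(u : ℂ) - I‖ = (u ^ 2 + 1) ^ (1 / 2 : ℝ) := by
  rw [← Real.sqrt_eq_rpow, Complex.norm_def, Complex.normSq_apply]
  congr 1
  simp
  ring

lemma hasDerivAt_osc (c u : ℝ) : HasDerivAt (osc c) (osc c u * (c * I)) u := by
  unfold osc
  have h1 : HasDerivAt (fun u : ℝ => (((c * u : ℝ) : ℂ) * I)) (c * I) u := by
    have : HasDerivAt (fun u : ℝ => c * u) c u := by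
      simpa using (hasDerivAt_id u).const_mul c
    exact this.ofReal_comp.mul_const I
  exact h1.cexp

lemma hasDerivAt_pw (r : ℂ) (u : ℝ) : HasDerivAt (pw r) (r * pw (r - 1) u * (2 * u)) u := by
  unfold pw
  have h1 : HasDerivAt (fun z : ℂ => z ^ 2 + 1) (2 * (u : ℂ)) (u : ℂ) := by
    simpa using (hasDerivAt_pow 2 (u : ℂ)).add_const 1
  exact (h1.cpow_const (c := r) (base_slit u)).comp_ofReal

lemma continuous_osc (c : ℝ) : Continuous (osc c) :=
  continuous_iff_continuousAt.2 fun u => (hasDerivAt_osc c u).continuousAt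

lemma continuous_pw (r : ℂ) : Continuous (pw r) :=
  continuous_iff_continuousAt.2 fun u => (hasDerivAt_pw r u).continuousAt

lemma integrand_eq (ν y : ℝ) (s : ℂ) (u : ℝ) :
    Complex.exp (-2 * Real.pi * I * ν * y * u) * ((u : ℂ) - I) / (((u : ℂ) ^ 2 + 1) ^ s)
      = osc (-2 * Real.pi * ν * y) u * ((u : ℂ) - I) * pw (-s) u := by
  unfold osc pw
  rw [Complex.cpow_neg, div_eq_mul_inv]
  congr 3
  push_cast
  ring

lemma integrable_maj (r : ℝ) (h : 1 < r) : Integrable (fun u : ℝ => (u ^ 2 + 1) ^ (-r / 2)) := by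
  have := integrable_rpow_neg_one_add_norm_sq (E := ℝ) (μ := volume) (r := r) (by simpa using h)
  refine this.congr (Filter.Eventually.of_forall fun u => ?_)
  simp [add_comm]

lemma norm_integrand_le (c : ℝ) (s : ℂ) (u a : ℝ) (h : a ≤ s.re) :
    ‖osc c u * ((u : ℂ) - I) * pw (-s) u‖ ≤ (u ^ 2 + 1) ^ (1 / 2 - a) := by
  rw [norm_mul, norm_mul, norm_osc, one_mul, norm_sub_I, sub_eq_add_neg,
    Real.rpow_add (by positivity)]
  gcongr
  exact norm_pw_le _ _ _ (by simpa using h)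

lemma cont_integrand (c : ℝ) (s : ℂ) :
    Continuous (fun u : ℝ => osc c u * ((u : ℂ) - I) * pw (-s) u) := by
  have := continuous_osc c
  have := continuous_pw (-s)
  fun_prop

lemma integrable_main (c : ℝ) (s : ℂ) (hs : 1 < s.re) :
    Integrable (fun u : ℝ => osc c u * ((u : ℂ) - I) * pw (-s) u) := by
  refine (integrable_maj (2 * s.re - 1) (by linarith)).mono'
    (cont_integrand c s).aestronglyMeasurable (Filter.Eventually.of_forall fun u => ?_)
  refine (norm_integrand_le c s u _ le_rfl).trans_eq ?_
  congr 1
  ring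

lemma hasDerivAt_pw_param (s : ℂ) (u : ℝ) :
    HasDerivAt (fun s : ℂ => pw (-s) u) (pw (-s) u * (-Complex.log ((u : ℂ) ^ 2 + 1))) s := by
  unfold pw
  have := (hasDerivAt_neg s).const_cpow (c := ((u : ℂ) ^ 2 + 1)) (Or.inl (base_ne u))
  convert this using 1
  ring

lemma differentiable_main (c : ℝ) :
    DifferentiableOn ℂ (fun s : ℂ => ∫ u : ℝ, osc c u * ((u : ℂ) - I) * pw (-s) u)
      {s : ℂ | 1 < s.re} := by
  intro s₀ hs₀
  simp only [Set.mem_ofPred_eq] at hs₀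
  set δ := (s₀.re - 1) / 2 with hδ
  have hδ0 : 0 < δ := by linarith
  have hopen : IsOpen {s : ℂ | 1 + δ < s.re} := isOpen_lt continuous_const Complex.continuous_re
  have hlog : Continuous fun u : ℝ => Complex.log ((u : ℂ) ^ 2 + 1) := by
    apply Continuous.clog
    · fun_prop
    · exact base_slit
  have := (hasDerivAt_integral_of_dominated_loc_of_deriv_le (μ := volume)
    (F := fun (s : ℂ) (u : ℝ) => osc c u * ((u : ℂ) - I) * pw (-s) u)
    (F' := fun (s : ℂ) (u : ℝ) =>
      osc c u * ((u : ℂ) - I) * (pw (-s) u * (-Complex.log ((u : ℂ) ^ 2 + 1))))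
    (x₀ := s₀) (s := {s : ℂ | 1 + δ < s.re})
    (bound := fun u => (u ^ 2 + 1) ^ (-(1 + δ) / 2) * (δ / 2)⁻¹)
    (hopen.mem_nhds (by simp only [Set.mem_ofPred_eq]; linarith))
    (Filter.Eventually.of_forall fun s => (cont_integrand c s).aestronglyMeasurable)
    (integrable_main c s₀ hs₀)
    ?_ ?_ ?_ ?_).2
  · exact this.differentiableAt.differentiableWithinAt
  · have h := (cont_integrand c s₀).mul hlog.neg
    refine Continuous.aestronglyMeasurable ?_
    refine h.congr fun u => ?_
    simp only [Pi.mul_apply, Pi.neg_apply]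
    ring
  · refine Filter.Eventually.of_forall fun u s hs => ?_
    simp only [Set.mem_ofPred_eq] at hs
    rw [← mul_assoc, norm_mul, norm_neg]
    have h1 := norm_integrand_le c s u (1 + δ) hs.le
    have hge : (1 : ℝ) ≤ u ^ 2 + 1 := by nlinarith [sq_nonneg u]
    have h2 : ‖Complex.log ((u : ℂ) ^ 2 + 1)‖ ≤ (u ^ 2 + 1) ^ (δ / 2) / (δ / 2) := by
      rw [base_cast, ← Complex.ofReal_log (by positivity), Complex.norm_real, Real.norm_eq_abs,
        abs_of_nonneg (Real.log_nonneg hge)]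
      exact Real.log_le_rpow_div (by positivity) (by positivity)
    refine (mul_le_mul h1 h2 (norm_nonneg _) (by positivity)).trans_eq ?_
    rw [div_eq_mul_inv _ (δ / 2), ← mul_assoc, ← Real.rpow_add (by positivity)]
    congr 2
    ring
  · exact (integrable_maj (1 + δ) (by linarith)).mul_const _
  · exact Filter.Eventually.of_forall fun u s _ => (hasDerivAt_pw_param s u).const_mul _

lemma integrable_pw (c : ℝ) (s : ℂ) (hs : 1 ≤ s.re) :
    Integrable (fun u : ℝ => osc c u * pw (-s) u) := by
  refine integrable_inv_one_add_sq.mono'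
    ((continuous_osc c).mul (continuous_pw _)).aestronglyMeasurable
    (Filter.Eventually.of_forall fun u => ?_)
  rw [norm_mul, norm_osc, one_mul, add_comm]
  exact norm_pw_le_inv _ _ (by simpa using hs)

lemma norm_integral_pw (c : ℝ) (s : ℂ) (hs : 1 ≤ s.re) :
    ‖∫ u : ℝ, osc c u * pw (-s) u‖ ≤ Real.pi := by
  rw [← integral_univ_inv_one_add_sq]
  refine norm_integral_le_of_norm_le integrable_inv_one_add_sq
    (Filter.Eventually.of_forall fun u => ?_)
  rw [norm_mul, norm_osc, one_mul, add_comm]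
  exact norm_pw_le_inv _ _ (by simpa using hs)

lemma cont_J (c : ℝ) (s : ℂ) : Continuous (fun u : ℝ => osc c u * (u * pw (-s) u)) := by
  have := continuous_osc c
  have := continuous_pw (-s)
  fun_prop

/-- inner piece -/
lemma inner_bound (c : ℝ) (s : ℂ) (hs : 1 ≤ s.re) :
    ‖∫ u in (0 : ℝ)..‖s‖, osc c u * (u * pw (-s) u)‖ ≤ 3 + |c| := by
  have hA : 1 ≤ ‖s‖ := hs.trans (Complex.re_le_norm s)
  by_cases h2 : ‖s‖ ≤ 2
  · have : ‖∫ u in (0 : ℝ)..‖s‖, osc c u * (u * pw (-s) u)‖ ≤ 1 * |‖s‖ - 0| := by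
      refine intervalIntegral.norm_integral_le_of_norm_le_const fun u _ => ?_
      rw [norm_mul, norm_mul, norm_osc, one_mul, Complex.norm_real, Real.norm_eq_abs]
      have h := norm_pw_le_inv (-s) u (by simpa using hs)
      calc |u| * ‖pw (-s) u‖ ≤ |u| * (u ^ 2 + 1)⁻¹ := by gcongr
        _ ≤ 1 := by
          rw [← div_eq_mul_inv, div_le_one (by positivity)]
          nlinarith [sq_abs u, sq_nonneg (|u| - 1), abs_nonneg u]
    rw [sub_zero, abs_of_nonneg (by positivity), one_mul] at this
    linarith [abs_nonneg c]
  push Not at h2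
  have hd : ‖s‖ / 2 ≤ ‖1 - s‖ := by
    have := norm_sub_norm_le s 1
    rw [norm_sub_rev] at this
    simp at this
    linarith
  have hne : (1 - s) ≠ 0 := by
    intro h
    rw [h, norm_zero] at hd
    linarith
  set G : ℝ → ℂ := fun u => osc c u * (pw (1 - s) u / (2 * (1 - s))) with hG
  have hGd : ∀ u, HasDerivAt G (osc c u * (c * I) * (pw (1 - s) u / (2 * (1 - s)))
      + osc c u * (u * pw (-s) u)) u := by
    intro u
    have h := (hasDerivAt_osc c u).mul ((hasDerivAt_pw (1 - s) u).div_const (2 * (1 - s)))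
    refine h.congr_deriv ?_
    rw [show (1 - s - 1) = -s by ring]
    field_simp
  have hc1 : Continuous fun u => osc c u * (c * I) * (pw (1 - s) u / (2 * (1 - s))) := by
    have := continuous_osc c
    have := continuous_pw (1 - s)
    fun_prop
  have key := intervalIntegral.integral_eq_sub_of_hasDerivAt (a := 0) (b := ‖s‖)
    (fun u _ => hGd u) ((hc1.add (cont_J c s)).intervalIntegrable _ _)
  rw [intervalIntegral.integral_add (hc1.intervalIntegrable _ _)
    ((cont_J c s).intervalIntegrable _ _)] at key
  have hp : ∀ u, ‖pw (1 - s) u / (2 * (1 - s))‖ ≤ 1 / ‖s‖ := by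
    intro u
    have h := norm_pw_le (1 - s) u 0 (by simpa using hs)
    rw [Real.rpow_zero] at h
    rw [norm_div]
    apply div_le_div₀ zero_le_one h (by linarith)
    rw [norm_mul]
    simp
    linarith
  have hGn : ∀ u, ‖G u‖ ≤ 1 := by
    intro u
    rw [hG, norm_mul, norm_osc, one_mul]
    refine (hp u).trans ?_
    rw [div_le_one (by linarith)]
    exact hA
  have h3 : ‖∫ u in (0 : ℝ)..‖s‖, osc c u * (c * I) * (pw (1 - s) u / (2 * (1 - s)))‖
      ≤ (|c| * (1 / ‖s‖)) * |‖s‖ - 0| := by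
    refine intervalIntegral.norm_integral_le_of_norm_le_const fun u _ => ?_
    rw [norm_mul, norm_mul, norm_mul, norm_osc, one_mul, Complex.norm_real, Real.norm_eq_abs,
      Complex.norm_I, mul_one]
    gcongr
    exact hp u
  have h4 : (|c| * (1 / ‖s‖)) * |‖s‖ - 0| = |c| := by
    rw [sub_zero, abs_norm]
    field_simp
  rw [h4] at h3
  rw [← eq_sub_iff_add_eq'] at key
  rw [key]
  calc _ ≤ ‖G ‖s‖‖ + ‖G 0‖ + |c| := by
        refine (norm_sub_le _ _).trans ?_
        gcongr
        exact norm_sub_le _ _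
    _ ≤ 3 + |c| := by linarith [hGn ‖s‖, hGn 0]

lemma outer_bound (c : ℝ) (hc : c ≠ 0) (s : ℂ) (hs : 1 ≤ s.re)
    (hJint : IntegrableOn (fun u : ℝ => osc c u * (u * pw (-s) u)) (Set.Ioi 0)) :
    ‖∫ u in Set.Ioi ‖s‖, osc c u * (u * pw (-s) u)‖ ≤ 4 / |c| := by
  have hA : 1 ≤ ‖s‖ := hs.trans (Complex.re_le_norm s)
  have hA0 : 0 < ‖s‖ := by linarith
  have hJtail : IntegrableOn (fun u : ℝ => osc c u * (u * pw (-s) u)) (Set.Ioi ‖s‖) :=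
    hJint.mono_set (Set.Ioi_subset_Ioi hA0.le)
  have hb : ∀ u, ‖osc c u * (u * pw (-s) u)‖ ≤ |u| * (u ^ 2 + 1)⁻¹ := by
    intro u
    rw [norm_mul, norm_mul, norm_osc, one_mul, Complex.norm_real, Real.norm_eq_abs]
    gcongr
    exact norm_pw_le_inv (-s) u (by simpa using hs)
  have hb' : ∀ u : ℝ, 0 < u → ‖osc c u * (u * pw (-s) u)‖ ≤ u⁻¹ := by
    intro u hu
    refine (hb u).trans ?_
    rw [abs_of_pos hu, ← div_eq_mul_inv, div_le_iff₀ (by positivity)]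
    field_simp
    linarith
  set R : ℝ → ℂ := fun u => osc c u * (1 * pw (-s) u + u * (-s * pw (-s - 1) u * (2 * u))) with hR
  have hder : ∀ u, HasDerivAt (fun u : ℝ => osc c u * (u * pw (-s) u))
      ((c * I) * (osc c u * (u * pw (-s) u)) + R u) u := by
    intro u
    have h := (hasDerivAt_osc c u).mul ((hasDerivAt_id u).ofReal_comp.mul (hasDerivAt_pw (-s) u))
    refine h.congr_deriv ?_
    simp [hR]
    ring
  have hRc : Continuous R := by
    have := continuous_osc c
    have := continuous_pw (-s)
    have := continuous_pw (-s - 1)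
    fun_prop
  have hRb : ∀ u ∈ Set.Ioi ‖s‖, ‖R u‖ ≤ (1 + 2 * ‖s‖) * u ^ (-2 : ℝ) := by
    intro u hu
    have hu0 : 0 < u := hA0.trans hu
    have e1 := norm_pw_le_inv (-s) u (by simpa using hs)
    have e2 := norm_pw_le (-s - 1) u (-2) (by simp; linarith)
    have e3 : (u ^ 2 + 1 : ℝ) ^ (-2 : ℝ) = ((u ^ 2 + 1) ^ 2)⁻¹ := by
      rw [Real.rpow_neg (by positivity)]; norm_cast
    have e4 : u ^ (-2 : ℝ) = (u ^ 2)⁻¹ := by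
      rw [Real.rpow_neg (by positivity)]; norm_cast
    rw [e3] at e2
    rw [e4, hR, norm_mul, norm_osc, one_mul, one_mul]
    have e5 : ‖pw (-s) u‖ ≤ (u ^ 2)⁻¹ := e1.trans (by gcongr; linarith)
    have e6 : ‖(u : ℂ) * (-s * pw (-s - 1) u * (2 * u))‖ ≤ 2 * ‖s‖ * (u ^ 2)⁻¹ := by
      simp only [norm_mul, norm_neg, Complex.norm_real, Real.norm_eq_abs, abs_of_pos hu0,
        Complex.norm_ofNat]
      have e7 : ‖pw (-s - 1) u‖ ≤ ((u ^ 2) ^ 2)⁻¹ := e2.trans (by gcongr; linarith)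
      calc u * (‖s‖ * ‖pw (-s - 1) u‖ * (2 * u)) ≤ u * (‖s‖ * ((u ^ 2) ^ 2)⁻¹ * (2 * u)) := by
            gcongr
        _ = 2 * ‖s‖ * (u ^ 2)⁻¹ := by field_simp
    calc _ ≤ _ := norm_add_le _ _
      _ ≤ (u ^ 2)⁻¹ + 2 * ‖s‖ * (u ^ 2)⁻¹ := add_le_add e5 e6
      _ = _ := by ring
  have hmaj : IntegrableOn (fun u : ℝ => (1 + 2 * ‖s‖) * u ^ (-2 : ℝ)) (Set.Ioi ‖s‖) :=
    (integrableOn_Ioi_rpow_of_lt (by norm_num) hA0).const_mul _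
  have hae : ∀ᵐ u ∂(volume.restrict (Set.Ioi ‖s‖)), ‖R u‖ ≤ (1 + 2 * ‖s‖) * u ^ (-2 : ℝ) :=
    (ae_restrict_iff' measurableSet_Ioi).2 (Filter.Eventually.of_forall hRb)
  have hRi : IntegrableOn R (Set.Ioi ‖s‖) := Integrable.mono' hmaj hRc.aestronglyMeasurable hae
  have hRn : ‖∫ u in Set.Ioi ‖s‖, R u‖ ≤ 3 := by
    refine (norm_integral_le_of_norm_le hmaj hae).trans ?_
    rw [integral_const_mul, integral_Ioi_rpow_of_lt (by norm_num) hA0,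
      show (-2 + 1 : ℝ) = -1 by norm_num, Real.rpow_neg_one, neg_div_neg_eq, div_one,
      ← div_eq_mul_inv, div_le_iff₀ hA0]
    linarith
  have hlim : Filter.Tendsto (fun u : ℝ => osc c u * (u * pw (-s) u)) Filter.atTop (nhds 0) := by
    refine squeeze_zero_norm' ?_ tendsto_inv_atTop_zero
    filter_upwards [Filter.eventually_gt_atTop 0] with u hu using hb' u hu
  have key := integral_Ioi_of_hasDerivAt_of_tendsto (a := ‖s‖)
    (cont_J c s).continuousWithinAt (fun u _ => hder u)
    ((hJtail.const_mul _).add hRi) hlim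
  rw [integral_add (hJtail.const_mul _) hRi, integral_const_mul, ← eq_sub_iff_add_eq] at key
  have hfin := congrArg norm key
  rw [norm_mul, norm_mul, Complex.norm_real, Real.norm_eq_abs, Complex.norm_I, mul_one] at hfin
  have hcp : 0 < |c| := abs_pos.2 hc
  rw [le_div_iff₀ hcp, mul_comm, hfin]
  refine (norm_sub_le _ _).trans ?_
  rw [zero_sub, norm_neg]
  have : (‖s‖)⁻¹ ≤ 1 := inv_le_one_of_one_le₀ hA
  linarith [hb' ‖s‖ hA0]

lemma half_bound (c : ℝ) (hc : c ≠ 0) (s : ℂ) (hs : 1 ≤ s.re)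
    (hJint : IntegrableOn (fun u : ℝ => osc c u * (u * pw (-s) u)) (Set.Ioi 0)) :
    ‖∫ u in Set.Ioi (0 : ℝ), osc c u * (u * pw (-s) u)‖ ≤ 3 + |c| + 4 / |c| := by
  rw [← intervalIntegral.integral_interval_add_Ioi hJint
    (hJint.mono_set (Set.Ioi_subset_Ioi (norm_nonneg s)))]
  exact (norm_add_le _ _).trans (add_le_add (inner_bound c s hs) (outer_bound c hc s hs hJint))

lemma full_bound (c : ℝ) (s : ℂ) (hs : 1 ≤ s.re)
    (hJint : Integrable (fun u : ℝ => osc c u * (u * pw (-s) u))) :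
    ‖∫ u : ℝ, osc c u * (u * pw (-s) u)‖ ≤ 2 * (3 + |c| + 4 / |c|) := by
  have hneg : ∀ u : ℝ, osc c (-u) * (((-u : ℝ) : ℂ) * pw (-s) (-u))
      = -(osc (-c) u * (u * pw (-s) u)) := by
    intro u
    simp [osc, pw]
  have hJneg : Integrable (fun u : ℝ => osc (-c) u * (u * pw (-s) u)) := by
    have := hJint.comp_neg.neg
    refine this.congr (Filter.Eventually.of_forall fun u => ?_)
    simp only [Pi.neg_apply]
    rw [hneg, neg_neg]
  rw [← intervalIntegral.integral_Iic_add_Ioi (b := 0) hJint.integrableOn hJint.integrableOn]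
  have h := integral_comp_neg_Ioi 0 (fun u : ℝ => osc c u * (u * pw (-s) u))
  rw [neg_zero] at h
  rw [← h]
  simp only [hneg]
  rw [integral_neg]
  by_cases hc : c = 0
  · subst hc
    simp only [neg_zero, neg_add_cancel, norm_zero]
    positivity
  · refine (norm_add_le _ _).trans ?_
    rw [norm_neg, two_mul]
    have h1 := half_bound (-c) (neg_ne_zero.2 hc) s hs hJneg.integrableOn
    rw [abs_neg] at h1
    exact add_le_add h1 (half_bound c hc s hs hJint.integrableOn)

lemma bounded_main (c : ℝ) (s : ℂ) (hs : 1 ≤ s.re) :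
    ‖∫ u : ℝ, osc c u * ((u : ℂ) - I) * pw (-s) u‖
      ≤ 2 * (3 + |c| + 4 / |c|) + Real.pi := by
  by_cases hi : Integrable (fun u : ℝ => osc c u * ((u : ℂ) - I) * pw (-s) u)
  · have hK := (integrable_pw c s hs).const_mul I
    have hJ : Integrable (fun u : ℝ => osc c u * (u * pw (-s) u)) := by
      refine (hi.add hK).congr (Filter.Eventually.of_forall fun u => ?_)
      simp only [Pi.add_apply]
      ring
    have heq : (fun u : ℝ => osc c u * ((u : ℂ) - I) * pw (-s) u)
        = fun u : ℝ => osc c u * (u * pw (-s) u) - I * (osc c u * pw (-s) u) := by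
      funext u
      ring
    rw [heq, integral_sub hJ hK, integral_const_mul]
    refine (norm_sub_le _ _).trans (add_le_add (full_bound c s hs hJ) ?_)
    rw [norm_mul, Complex.norm_I, one_mul]
    exact norm_integral_pw c s hs
  · rw [integral_undef hi, norm_zero]
    positivity

/-- The integral `∫ e^{-2πiνyu}(u-i)/(u²+1)^s du` converges absolutely for `Re s > 1`,
is holomorphic in `s` on `Re s > 1`, and (for `ν ≠ 0`) is uniformly bounded on `Re s ≥ 1`. -/
theorem integral_convergence_holomorphy_boundedness (ν y : ℝ) (hν : ν ≠ 0) :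
    (∀ s : ℂ, 1 < s.re →
      Integrable (fun u : ℝ =>
        Complex.exp (-2 * Real.pi * I * ν * y * u) * ((u : ℂ) - I) / (((u : ℂ) ^ 2 + 1) ^ s))) ∧
    DifferentiableOn ℂ
      (fun s : ℂ => ∫ u : ℝ,
        Complex.exp (-2 * Real.pi * I * ν * y * u) * ((u : ℂ) - I) / (((u : ℂ) ^ 2 + 1) ^ s))
      {s : ℂ | 1 < s.re} ∧
    ∃ M : ℝ, ∀ s : ℂ, 1 ≤ s.re →
      ‖∫ u : ℝ, Complex.exp (-2 * Real.pi * I * ν * y * u) * ((u : ℂ) - I) /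
          (((u : ℂ) ^ 2 + 1) ^ s)‖ ≤ M := by
  simp only [integrand_eq]
  exact ⟨fun s hs => integrable_main _ s hs, differentiable_main _,
    _, fun s hs => bounded_main _ s hs⟩
end
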